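/- Let A be an N×N Hermitian complex matrix with eigenvalues ξ_1,…,ξ_N and let ρ be an N×N positive semidefinite Hermitian complex matrix with eigenvalues λ_1,…,λ_N. Then Tr(Aρ) ≤ Σ_{i=1}^N ξ↓_i · λ↓_i, where ξ↓ and λ↓ list the eigenvalues in nonincreasing order. In particular, Tr(Aρ) ≤ ξ↓_1 · Tr(ρ) when ρ has trace equal to Tr(ρ) concentrated by λ↓; and the bound Σ_i ξ↓_i λ↓_i is attained by some ρ with eigenvalues λ (namely one whose eigenbasis matches that of A appropriately). -/

import Mathlib

/-- The nonincreasing rearrangement `a↓` of a vector `a : Fin N → ℝ`. -/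
noncomputable def sortDesc {N : ℕ} (a : Fin N → ℝ) : Fin N → ℝ :=
  fun i => a (Tuple.sort a (Fin.rev i))

/-- `pSum a k` is the sum of the `k` largest entries of `a`,
i.e. `Σ_{i=1}^k a↓_i`. -/
noncomputable def pSum {N : ℕ} (a : Fin N → ℝ) (k : ℕ) : ℝ :=
  ∑ i ∈ Finset.univ.filter (fun i : Fin N => (i : ℕ) < k), sortDesc a i

/-- Majorization `a ≺ b`. -/
noncomputable def Maj {N : ℕ} (a b : Fin N → ℝ) : Prop :=
  (∀ k : ℕ, pSum a k ≤ pSum b k) ∧ (∑ i, a i = ∑ i, b i)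

/-- `P^N` with total sum `c`: entries in `[0,1]`, nonincreasing, summing to `c`. -/
def Pset (N : ℕ) (c : ℝ) : Set (Fin N → ℝ) :=
  {p | (∀ i, 0 ≤ p i ∧ p i ≤ 1) ∧ (∀ i j : Fin N, i ≤ j → p j ≤ p i) ∧ ∑ i, p i = c}

/-- A Hermitian matrix with spectrum `lam`: unitarily diagonalizable with real
diagonal `lam`. -/
def hasSpectrum {N : ℕ} (A : Matrix (Fin N) (Fin N) ℂ) (lam : Fin N → ℝ) : Prop :=
  ∃ U ∈ Matrix.unitaryGroup (Fin N) ℂ,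
    A = U * Matrix.diagonal (fun i => (lam i : ℂ)) * star (U : Matrix (Fin N) (Fin N) ℂ)

open Matrix in
theorem aux_trace {N : ℕ} (U V : Matrix (Fin N) (Fin N) ℂ) (ξ lam : Fin N → ℝ) :
    ((U * Matrix.diagonal (fun i => (ξ i : ℂ)) * star U) *
      (V * Matrix.diagonal (fun i => (lam i : ℂ)) * star V)).trace =
    ((∑ i, ∑ j, ξ i * lam j * Complex.normSq ((star U * V) i j) : ℝ) : ℂ) := by
  have h : ((U * Matrix.diagonal (fun i => (ξ i : ℂ)) * star U) *
      (V * Matrix.diagonal (fun i => (lam i : ℂ)) * star V)).trace =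
      ((Matrix.diagonal (fun i => (ξ i : ℂ)) * (star U * V)) *
      (Matrix.diagonal (fun i => (lam i : ℂ)) * star (star U * V))).trace := by
    rw [star_mul, star_star]
    have h1 : (U * Matrix.diagonal (fun i => (ξ i : ℂ)) * star U) *
      (V * Matrix.diagonal (fun i => (lam i : ℂ)) * star V) =
      U * (Matrix.diagonal (fun i => (ξ i : ℂ)) * star U *
      (V * Matrix.diagonal (fun i => (lam i : ℂ)) * star V)) := by
      simp only [mul_assoc]
    rw [h1, Matrix.trace_mul_comm]
    simp only [mul_assoc]
  rw [h]
  generalize star U * V = W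
  simp only [Matrix.trace, Matrix.diag, Matrix.mul_apply (M := Matrix.diagonal _ * W),
    Matrix.diagonal_mul, Matrix.star_apply]
  push_cast
  refine Finset.sum_congr rfl fun i _ => Finset.sum_congr rfl fun j _ => ?_
  rw [Complex.normSq_eq_conj_mul_self]
  simp only [RCLike.star_def]
  ring

noncomputable def auxPerm {N : ℕ} (a : Fin N → ℝ) : Equiv.Perm (Fin N) :=
  Fin.revPerm.trans (Tuple.sort a)

theorem aux_sortDesc {N : ℕ} (a : Fin N → ℝ) (i : Fin N) :
    sortDesc a i = a (auxPerm a i) := rfl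

theorem aux_antitone {N : ℕ} (a : Fin N → ℝ) : Antitone (sortDesc a) := by
  intro i j h
  exact Tuple.monotone_sort a (Fin.rev_le_rev.mpr h)

theorem aux_perm {N : ℕ} (ξ lam : Fin N → ℝ) (σ : Equiv.Perm (Fin N)) :
    ∑ i, ξ i * lam (σ i) ≤ ∑ i, sortDesc ξ i * sortDesc lam i := by
  have hm : Monovary (sortDesc ξ) (sortDesc lam) :=
    (aux_antitone ξ).monovary (aux_antitone lam)
  have := hm.sum_mul_comp_perm_le_sum_mul
    (σ := (auxPerm ξ).trans (σ.trans (auxPerm lam).symm))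
  refine le_trans (le_of_eq ?_) this
  rw [← Equiv.sum_comp (auxPerm ξ)]
  simp [aux_sortDesc]

theorem aux_ds {N : ℕ} (W : Matrix (Fin N) (Fin N) ℂ) (hW : W ∈ Matrix.unitaryGroup (Fin N) ℂ) :
    (Matrix.of fun i j => Complex.normSq (W i j)) ∈ doublyStochastic ℝ (Fin N) := by
  rw [mem_doublyStochastic_iff_sum]
  refine ⟨fun i j => Complex.normSq_nonneg _, fun i => ?_, fun j => ?_⟩
  · have h := congrFun (congrFun (Matrix.mem_unitaryGroup_iff.mp hW) i) i
    rw [Matrix.mul_apply] at h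
    simp only [Matrix.star_apply, RCLike.star_def, Matrix.one_apply_eq, Complex.mul_conj] at h
    exact_mod_cast h
  · have h := congrFun (congrFun (Matrix.mem_unitaryGroup_iff'.mp hW) j) j
    rw [Matrix.mul_apply] at h
    simp only [Matrix.star_apply, RCLike.star_def, Matrix.one_apply_eq,
      ← Complex.normSq_eq_conj_mul_self] at h
    exact_mod_cast h

theorem aux_bound {N : ℕ} (S : Matrix (Fin N) (Fin N) ℝ) (hS : S ∈ doublyStochastic ℝ (Fin N))
    (ξ lam : Fin N → ℝ) :
    ∑ i, ∑ j, ξ i * lam j * S i j ≤ ∑ i, sortDesc ξ i * sortDesc lam i := by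
  obtain ⟨w, hw0, hw1, rfl⟩ := exists_eq_sum_perm_of_mem_doublyStochastic hS
  have h1 : ∑ i, ∑ j, ξ i * lam j * (∑ σ, w σ • Equiv.Perm.permMatrix ℝ σ) i j =
      ∑ σ : Equiv.Perm (Fin N), w σ * ∑ i, ξ i * lam (σ i) := by
    simp only [Matrix.sum_apply, Finset.mul_sum]
    have : ∀ i, ∑ j, ∑ σ : Equiv.Perm (Fin N),
        ξ i * lam j * (w σ • Equiv.Perm.permMatrix ℝ σ) i j =
        ∑ σ : Equiv.Perm (Fin N), w σ * (ξ i * lam (σ i)) := by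
      intro i
      rw [Finset.sum_comm]
      refine Finset.sum_congr rfl fun σ _ => ?_
      rw [Finset.sum_eq_single (σ i)]
      · simp [Equiv.Perm.permMatrix, PEquiv.toMatrix_apply]; ring
      · intro j _ hj
        simp [Equiv.Perm.permMatrix, PEquiv.toMatrix_apply, hj.symm]
      · simp
    rw [Finset.sum_congr rfl fun i _ => this i, Finset.sum_comm]
  rw [h1]
  calc _ ≤ ∑ σ : Equiv.Perm (Fin N), w σ * ∑ i, sortDesc ξ i * sortDesc lam i :=
        Finset.sum_le_sum fun σ _ => mul_le_mul_of_nonneg_left (aux_perm ξ lam σ) (hw0 σ)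
    _ = _ := by rw [← Finset.sum_mul, hw1, one_mul]

/-- Von Neumann-type trace inequality: for a Hermitian `A` with eigenvalues `ξ`
and a positive semidefinite `ρ` with (nonnegative) eigenvalues `λ`,
`Tr(Aρ) ≤ Σ_i ξ↓_i λ↓_i ≤ ξ↓_1 Tr(ρ)`, and the bound `Σ_i ξ↓_i λ↓_i` is
attained by some `ρ'` with eigenvalues `λ`. -/
theorem trace_product_eigenvalue_bound (N : ℕ) (hN : 0 < N)
    (A ρ : Matrix (Fin N) (Fin N) ℂ) (ξ lam : Fin N → ℝ)
    (hA : hasSpectrum A ξ) (hρ : hasSpectrum ρ lam) (hlam0 : ∀ i, 0 ≤ lam i) :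
    ((A * ρ).trace).re ≤ ∑ i, sortDesc ξ i * sortDesc lam i ∧
    ((A * ρ).trace).re ≤ sortDesc ξ ⟨0, hN⟩ * ∑ i, lam i ∧
    ∃ ρ' : Matrix (Fin N) (Fin N) ℂ, hasSpectrum ρ' lam ∧
      (A * ρ').trace = ((∑ i, sortDesc ξ i * sortDesc lam i : ℝ) : ℂ) := by
  obtain ⟨U, hU, rfl⟩ := hA
  obtain ⟨V, hV, rfl⟩ := hρ
  have hds := aux_ds (star U * V) (mul_mem (Unitary.star_mem hU) hV)
  rw [aux_trace, Complex.ofReal_re]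
  refine ⟨aux_bound _ hds ξ lam, ?_, ?_⟩
  · rw [mem_doublyStochastic_iff_sum] at hds
    obtain ⟨h0, -, h2⟩ := hds
    have hmax : ∀ i, ξ i ≤ sortDesc ξ ⟨0, hN⟩ := by
      intro i
      have h := aux_antitone ξ (show (⟨0, hN⟩ : Fin N) ≤ (auxPerm ξ).symm i from Nat.zero_le _)
      simpa [aux_sortDesc ξ ((auxPerm ξ).symm i)] using h
    rw [Finset.sum_comm, Finset.mul_sum]
    refine Finset.sum_le_sum fun j _ => ?_
    calc _ ≤ ∑ i, sortDesc ξ ⟨0, hN⟩ * lam j * Complex.normSq ((star U * V) i j) :=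
          Finset.sum_le_sum fun i _ => mul_le_mul_of_nonneg_right
            (mul_le_mul_of_nonneg_right (hmax i) (hlam0 j)) (h0 i j)
      _ = _ := by
          have := h2 j
          simp only [Matrix.of_apply] at this
          rw [← Finset.mul_sum, this, mul_one]
  · let π : Equiv.Perm (Fin N) := (auxPerm lam).symm.trans (auxPerm ξ)
    have hstar : star U * U.submatrix id π = (1 : Matrix (Fin N) (Fin N) ℂ).submatrix id π := by
      rw [← Matrix.mem_unitaryGroup_iff'.mp hU]
      rfl
    refine ⟨U.submatrix id π * Matrix.diagonal (fun i => (lam i : ℂ)) * star (U.submatrix id π),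
      ⟨U.submatrix id π, ?_, rfl⟩, ?_⟩
    · rw [Matrix.mem_unitaryGroup_iff, Matrix.star_eq_conjTranspose, Matrix.conjTranspose_submatrix,
        Matrix.submatrix_mul_equiv, ← Matrix.star_eq_conjTranspose,
        Matrix.mem_unitaryGroup_iff.mp hU, Matrix.submatrix_id_id]
    · rw [aux_trace, hstar]
      congr 1
      rw [Finset.sum_comm, ← Equiv.sum_comp (auxPerm lam)]
      refine Finset.sum_congr rfl fun k _ => ?_
      have hk : π (auxPerm lam k) = auxPerm ξ k := by simp [π]
      rw [Finset.sum_eq_single (auxPerm ξ k)]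
      · rw [Matrix.submatrix_apply, hk, id, Matrix.one_apply_eq]
        simp [aux_sortDesc]
      · intro j _ hj
        rw [Matrix.submatrix_apply, hk, id, Matrix.one_apply_ne hj]
        simp
      · simp
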